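/- Let p be a prime number, d an integer, and C a bounded cochain complex of finitely generated free modules over the ring ℤ_p of p-adic integers. Assume that H^q(C ⊗_{ℤ_p} ℚ_p) = 0 for all q ≠ d and H^q(C ⊗_{ℤ_p} 𝔽_p) = 0 for all q ≠ d. Then H^q(C) = 0 for all q ≠ d, and H^d(C) is a free ℤ_p-module of rank r, where r = dim_{ℚ_p} H^d(C ⊗_{ℤ_p} ℚ_p). -/

import Mathlib

open TensorProduct

noncomputable section

/-- Transport of a term of a `ℤ`-indexed family of modules along an equality of indices. -/
def lcast {R : Type} [Semiring R] (X : ℤ → Type) [∀ q, AddCommGroup (X q)]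
    [∀ q, Module R (X q)] {i j : ℤ} (h : i = j) : X i ≃ₗ[R] X j := by
  subst h; exact LinearEquiv.refl R (X i)

/-- Cohomology in degree `q` of a `ℤ`-indexed cochain complex `(X, δ)` of `R`-modules:
the kernel of `δ q` modulo the image of `δ (q - 1)`. -/
abbrev cohomology {R : Type} [CommRing R] (X : ℤ → Type) [∀ q, AddCommGroup (X q)]
    [∀ q, Module R (X q)] (δ : ∀ q : ℤ, X q →ₗ[R] X (q + 1)) (q : ℤ) : Type :=
  ↥(LinearMap.ker (δ q)) ⧸
    (LinearMap.range ((lcast X (show q - 1 + 1 = q by omega)).toLinearMap ∘ₗ δ (q - 1))).comap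
      (LinearMap.ker (δ q)).subtype

/-- `𝔽_p = ℤ/pℤ` is a `ℤ_[p]`-algebra via reduction mod `p`. -/
local instance (p : ℕ) [Fact p.Prime] : Algebra ℤ_[p] (ZMod p) :=
  (PadicInt.toZMod).toAlgebra

/-- The differential `X (q - 1) → X q` of a `ℤ`-indexed cochain complex. -/
abbrev incoming {R : Type} [CommRing R] (X : ℤ → Type) [∀ q, AddCommGroup (X q)]
    [∀ q, Module R (X q)] (δ : ∀ q : ℤ, X q →ₗ[R] X (q + 1)) (q : ℤ) : X (q - 1) →ₗ[R] X q :=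
  (lcast X (show q - 1 + 1 = q by omega)).toLinearMap ∘ₗ δ (q - 1)

section Complex

variable {R : Type} [CommRing R] (X : ℤ → Type) [∀ q, AddCommGroup (X q)]
  [∀ q, Module R (X q)] (δ : ∀ q : ℤ, X q →ₗ[R] X (q + 1))

lemma lcast_baseChange (S : Type) [CommRing S] [Algebra R S] {i j : ℤ} (h : i = j) :
    (lcast (fun n => S ⊗[R] X n) h : _ ≃ₗ[S] _).toLinearMap =
      (lcast X h : _ ≃ₗ[R] _).toLinearMap.baseChange S := by
  subst h
  exact LinearMap.baseChange_id.symm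

lemma incoming_baseChange (S : Type) [CommRing S] [Algebra R S] (q : ℤ) :
    incoming (fun n => S ⊗[R] X n) (fun n => (δ n).baseChange S) q =
      (incoming X δ q).baseChange S := by
  rw [incoming, incoming, lcast_baseChange, LinearMap.baseChange_comp]

variable {X δ}

lemma differential_lcast_eq_zero {i j : ℤ} (h : i = j) {x : X i} (hx : δ i x = 0) :
    δ j ((lcast X h : _ ≃ₗ[R] _) x) = 0 := by
  subst h
  exact hx

lemma differential_incoming (hδδ : ∀ (q : ℤ) (x : X q), δ (q + 1) (δ q x) = 0) (q : ℤ)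
    (y : X (q - 1)) : δ q (incoming X δ q y) = 0 :=
  differential_lcast_eq_zero _ (hδδ _ _)

lemma subsingleton_cohomology_iff (q : ℤ) :
    Subsingleton (cohomology X δ q) ↔
      LinearMap.ker (δ q) ≤ LinearMap.range (incoming X δ q) := by
  rw [Submodule.Quotient.subsingleton_iff, Submodule.comap_subtype_eq_top]

lemma finrank_cohomology_add [IsDomain R] [IsNoetherianRing R] [∀ q, Module.Finite R (X q)]
    (hδδ : ∀ (q : ℤ) (x : X q), δ (q + 1) (δ q x) = 0) (q : ℤ) :
    Module.finrank R (cohomology X δ q) + Module.finrank R (LinearMap.range (incoming X δ q)) +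
      Module.finrank R (LinearMap.range (δ q)) = Module.finrank R (X q) := by
  have hle : LinearMap.range (incoming X δ q) ≤ LinearMap.ker (δ q) := by
    rintro _ ⟨y, rfl⟩
    exact differential_incoming hδδ q y
  rw [← (Submodule.comapSubtypeEquivOfLe hle).finrank_eq,
    Submodule.finrank_quotient_add_finrank, ← (δ q).quotKerEquivRange.finrank_eq, add_comm,
    Submodule.finrank_quotient_add_finrank]

end Complex

lemma finrank_range_baseChange {R S M N : Type*} [CommRing R] [IsDomain R]
    [IsPrincipalIdealRing R] [CommRing S] [Nontrivial S] [Algebra R S] [Module.Flat R S]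
    [AddCommGroup M] [Module R M] [AddCommGroup N] [Module R N] [Module.Free R N]
    [Module.Finite R N] (f : M →ₗ[R] N) :
    Module.finrank S (LinearMap.range (f.baseChange S)) =
      Module.finrank R (LinearMap.range f) := by
  have hrange : LinearMap.range (f.baseChange S) = (LinearMap.range f).baseChange S := by
    have hf : f.baseChange S =
        (LinearMap.range f).subtype.baseChange S ∘ₗ f.rangeRestrict.baseChange S := by
      rw [← LinearMap.baseChange_comp, f.subtype_comp_codRestrict]
    have hsurj : LinearMap.range (f.rangeRestrict.baseChange S) = ⊤ :=
      LinearMap.range_eq_top.2 (LinearMap.lTensor_surjective S f.surjective_rangeRestrict)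
    rw [hf, LinearMap.range_comp, hsurj, Submodule.map_top, Submodule.baseChange]
  rw [hrange, ← (Submodule.toBaseChange.toLinearEquiv S (LinearMap.range f)).finrank_eq,
    Module.finrank_baseChange]

lemma finrank_cohomology_baseChange {R : Type} [CommRing R] [IsDomain R]
    [IsPrincipalIdealRing R] (S : Type) [Field S] [Algebra R S] [Module.Flat R S]
    {X : ℤ → Type} [∀ q, AddCommGroup (X q)] [∀ q, Module R (X q)]
    [∀ q, Module.Finite R (X q)] [∀ q, Module.Free R (X q)]
    {δ : ∀ q : ℤ, X q →ₗ[R] X (q + 1)}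
    (hδδ : ∀ (q : ℤ) (x : X q), δ (q + 1) (δ q x) = 0) (q : ℤ) :
    Module.finrank S (cohomology (fun n => S ⊗[R] X n) (fun n => (δ n).baseChange S) q) =
      Module.finrank R (cohomology X δ q) := by
  have hδδ' : ∀ (q : ℤ) (x : S ⊗[R] X q),
      (δ (q + 1)).baseChange S ((δ q).baseChange S x) = 0 := by
    intro q x
    have hcomp : δ (q + 1) ∘ₗ δ q = 0 := LinearMap.ext (hδδ q)
    rw [← LinearMap.comp_apply, ← LinearMap.baseChange_comp, hcomp, LinearMap.baseChange_zero,
      LinearMap.zero_apply]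
  have h := finrank_cohomology_add hδδ q
  have h' := finrank_cohomology_add (X := fun n => S ⊗[R] X n)
    (δ := fun n => (δ n).baseChange S) hδδ' q
  rw [incoming_baseChange, finrank_range_baseChange, finrank_range_baseChange,
    Module.finrank_baseChange] at h'
  omega

section Reduction

variable {p : ℕ} [Fact p.Prime]

lemma one_tmul_eq_zero_iff {M : Type*} [AddCommGroup M] [Module ℤ_[p] M]
    [Module.Free ℤ_[p] M] [Module.Finite ℤ_[p] M] (x : M) :
    (1 : ZMod p) ⊗ₜ[ℤ_[p]] x = 0 ↔ ∃ w : M, x = (p : ℤ_[p]) • w := by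
  constructor
  · intro h
    let b := Module.Free.chooseBasis ℤ_[p] M
    have hdvd : ∀ i, (p : ℤ_[p]) ∣ b.repr x i := by
      intro i
      have hi : algebraMap ℤ_[p] (ZMod p) (b.repr x i) = 0 := by
        have := b.baseChange_repr_tmul (ZMod p) 1 x i
        rw [h] at this
        simpa [Algebra.smul_def] using this.symm
      rw [← Ideal.mem_span_singleton, ← PadicInt.maximalIdeal_eq_span_p, ← PadicInt.ker_toZMod]
      exact hi
    choose c hc using hdvd
    refine ⟨∑ i, c i • b i, ?_⟩
    rw [Finset.smul_sum]
    conv_lhs => rw [← b.sum_repr x]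
    exact Finset.sum_congr rfl fun i _ => by rw [hc, mul_smul]
  · rintro ⟨w, rfl⟩
    rw [TensorProduct.tmul_smul, TensorProduct.smul_tmul', Algebra.smul_def, map_natCast,
      CharP.cast_eq_zero, zero_mul, TensorProduct.zero_tmul]

variable {X : ℤ → Type} [∀ q, AddCommGroup (X q)] [∀ q, Module ℤ_[p] (X q)]
  [∀ q, Module.Finite ℤ_[p] (X q)] [∀ q, Module.Free ℤ_[p] (X q)]
  {δ : ∀ q : ℤ, X q →ₗ[ℤ_[p]] X (q + 1)}

/-- If the mod `p` cohomology vanishes in degree `q`, every cocycle mod `p` is a coboundary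
mod `p`. -/
lemma exists_eq_incoming_add_smul {q : ℤ}
    (hF : Subsingleton (cohomology (fun n => (ZMod p) ⊗[ℤ_[p]] X n)
      (fun n => (δ n).baseChange (ZMod p)) q))
    {y : X q} {u : X (q + 1)} (hy : δ q y = (p : ℤ_[p]) • u) :
    ∃ z w, y = incoming X δ q z + (p : ℤ_[p]) • w := by
  rw [subsingleton_cohomology_iff, incoming_baseChange] at hF
  have hker : (1 : ZMod p) ⊗ₜ[ℤ_[p]] y ∈ LinearMap.ker ((δ q).baseChange (ZMod p)) := by
    rw [LinearMap.mem_ker, LinearMap.baseChange_tmul]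
    exact (one_tmul_eq_zero_iff _).2 ⟨u, hy⟩
  obtain ⟨t, ht⟩ := hF hker
  obtain ⟨z, rfl⟩ := TensorProduct.mk_surjective ℤ_[p] (X (q - 1)) (ZMod p)
    (ZMod.ringHom_surjective (PadicInt.toZMod (p := p))) t
  obtain ⟨w, hw⟩ := (one_tmul_eq_zero_iff (p := p) (y - incoming X δ q z)).1 (by
    rw [TensorProduct.tmul_sub, ← ht, TensorProduct.mk_apply, LinearMap.baseChange_tmul, sub_self])
  exact ⟨z, w, by rw [← hw]; abel⟩

lemma natCast_prime_ne_zero : (p : ℤ_[p]) ≠ 0 :=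
  Nat.cast_ne_zero.2 (Fact.out : p.Prime).ne_zero

lemma subsingleton_cohomology_of_mod (hδδ : ∀ (q : ℤ) (x : X q), δ (q + 1) (δ q x) = 0) {q : ℤ}
    (hF : Subsingleton (cohomology (fun n => (ZMod p) ⊗[ℤ_[p]] X n)
      (fun n => (δ n).baseChange (ZMod p)) q)) :
    Subsingleton (cohomology X δ q) := by
  rw [subsingleton_cohomology_iff]
  refine Submodule.le_of_le_smul_of_le_jacobson_bot (I := IsLocalRing.maximalIdeal ℤ_[p])
    (IsNoetherian.noetherian _) (IsLocalRing.maximalIdeal_le_jacobson _) fun x hx => ?_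
  rw [LinearMap.mem_ker] at hx
  obtain ⟨z, w, hzw⟩ := exists_eq_incoming_add_smul hF (u := 0) (by rw [hx, smul_zero])
  have hw : δ q w = 0 := by
    have h : (p : ℤ_[p]) • δ q w = 0 := by
      rw [← map_smul, ← hx, hzw, map_add, differential_incoming hδδ, zero_add]
    exact (smul_eq_zero.1 h).resolve_left natCast_prime_ne_zero
  rw [hzw]
  refine Submodule.add_mem_sup ⟨z, rfl⟩ (Submodule.smul_mem_smul ?_ hw)
  rw [PadicInt.maximalIdeal_eq_span_p]
  exact Ideal.mem_span_singleton_self _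

lemma mem_range_incoming_of_smul_mem (hδδ : ∀ (q : ℤ) (x : X q), δ (q + 1) (δ q x) = 0) {q : ℤ}
    (hF : Subsingleton (cohomology (fun n => (ZMod p) ⊗[ℤ_[p]] X n)
      (fun n => (δ n).baseChange (ZMod p)) (q - 1)))
    {x : X q} (hx : (p : ℤ_[p]) • x ∈ LinearMap.range (incoming X δ q)) :
    x ∈ LinearMap.range (incoming X δ q) := by
  obtain ⟨y, hy⟩ := hx
  have hy' : δ (q - 1) y =
      (p : ℤ_[p]) • (lcast X (show q - 1 + 1 = q by omega) : _ ≃ₗ[ℤ_[p]] _).symm x := by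
    rw [← map_smul, ← hy]
    exact (LinearEquiv.symm_apply_apply _ _).symm
  obtain ⟨z, w, rfl⟩ := exists_eq_incoming_add_smul hF hy'
  refine ⟨w, smul_right_injective _ (natCast_prime_ne_zero (p := p)) ?_⟩
  have hz : incoming X δ q (incoming X δ (q - 1) z) = 0 := by
    rw [LinearMap.comp_apply, differential_incoming hδδ, map_zero]
  simpa only [map_add, map_smul, hz, zero_add] using hy

lemma free_of_forall_smul_eq_zero {M : Type*} [AddCommGroup M] [Module ℤ_[p] M]
    [Module.Finite ℤ_[p] M] (h : ∀ x : M, (p : ℤ_[p]) • x = 0 → x = 0) :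
    Module.Free ℤ_[p] M := by
  rw [Module.free_iff_isTorsionFree, Module.isTorsionFree_iff_smul_eq_zero]
  intro r x hrx
  refine or_iff_not_imp_left.2 fun hr => ?_
  have hpow : ∀ n : ℕ, (p : ℤ_[p]) ^ n • x = 0 → x = 0 := by
    intro n
    induction n with
    | zero => simp
    | succ n ih => exact fun hn => ih (h _ (by rwa [smul_smul, ← pow_succ']))
  rw [PadicInt.unitCoeff_spec hr, mul_smul, ← Units.smul_def, smul_eq_zero_iff_eq] at hrx
  exact hpow _ hrx

end Reduction

/-- for a bounded cochain complex `(X, δ)` of finitely generated free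
`ℤ_p`-modules whose `ℚ_p`- and `𝔽_p`-cohomologies are both concentrated in degree `d`,
the integral cohomology `H^q(C)` vanishes for `q ≠ d` and `H^d(C)` is a free
`ℤ_p`-module of rank `r = dim_ℚp H^d(C ⊗ ℚ_p)`. -/
theorem concentrated_integral_cohomology_free (p : ℕ) [Fact p.Prime] (d : ℤ)
    (X : ℤ → Type) [∀ q, AddCommGroup (X q)] [∀ q, Module ℤ_[p] (X q)]
    [∀ q, Module.Finite ℤ_[p] (X q)] [∀ q, Module.Free ℤ_[p] (X q)]
    (δ : ∀ q : ℤ, X q →ₗ[ℤ_[p]] X (q + 1))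
    (hδδ : ∀ (q : ℤ) (x : X q), δ (q + 1) (δ q x) = 0)
    (hbdd : ∃ N : ℕ, ∀ q : ℤ, (N : ℤ) < |q| → Subsingleton (X q))
    (hQ : ∀ q : ℤ, q ≠ d →
      Subsingleton (cohomology (fun n => ℚ_[p] ⊗[ℤ_[p]] X n)
        (fun n => (δ n).baseChange ℚ_[p]) q))
    (hF : ∀ q : ℤ, q ≠ d →
      Subsingleton (cohomology (fun n => (ZMod p) ⊗[ℤ_[p]] X n)
        (fun n => (δ n).baseChange (ZMod p)) q)) :
    (∀ q : ℤ, q ≠ d → Subsingleton (cohomology X δ q)) ∧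
    Module.Free ℤ_[p] (cohomology X δ d) ∧
    Module.finrank ℤ_[p] (cohomology X δ d) =
      Module.finrank ℚ_[p]
        (cohomology (fun n => ℚ_[p] ⊗[ℤ_[p]] X n)
          (fun n => (δ n).baseChange ℚ_[p]) d) := by
  refine ⟨fun q hq => subsingleton_cohomology_of_mod hδδ (hF q hq),
    free_of_forall_smul_eq_zero fun x => ?_, ?_⟩
  · induction x using Submodule.Quotient.induction_on with
    | _ x =>
      rw [← Submodule.Quotient.mk_smul, Submodule.Quotient.mk_eq_zero,
        Submodule.Quotient.mk_eq_zero]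
      exact mem_range_incoming_of_smul_mem hδδ (hF (d - 1) (by omega))
  · have : Module.Flat ℤ_[p] ℚ_[p] := IsLocalization.flat ℚ_[p] (nonZeroDivisors ℤ_[p])
    exact (finrank_cohomology_baseChange ℚ_[p] hδδ d).symm
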